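/- Define the recursive procedure Solve on vertices s of the Zielonka tree Z_φ together with a list ls assigning a subset of V to every strict ancestor of s: initialize X := ∅ if s ∈ T_○ and X := V if s ∈ T_□, and repeat until X stabilizes: if s is not a leaf, replace X by the union (when s ∈ T_○) or intersection (when s ∈ T_□) of Solve(t, ls:X) over all children t of s; if s is a leaf, replace X by ⋃_{t ≤ s} (anc^t_s ∩ CPre((ls:X)(t))). Then Solve(r, []) at the root r equals ⟦X_r⟧, the solution of the Emerson-Lei equation system S_φ at the root; in particular, the procedure terminates and each fixpoint loop stabilizes after at most |V| iterations. -/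

import Mathlib

/-- Emerson-Lei formulas over a set `C` of colors: Boolean formulas over atoms `Inf c`. -/
inductive ELFormula (C : Type) : Type
  | tt : ELFormula C
  | ff : ELFormula C
  | inf : C → ELFormula C
  | not : ELFormula C → ELFormula C
  | and : ELFormula C → ELFormula C → ELFormula C
  | or : ELFormula C → ELFormula C → ELFormula C

/-- Satisfaction of an Emerson-Lei formula by a set `D` of colors. -/
def ELSat {C : Type} (D : Set C) : ELFormula C → Prop
  | .tt => True
  | .ff => False
  | .inf c => c ∈ D
  | .not f => ¬ ELSat D f
  | .and f g => ELSat D f ∧ ELSat D g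
  | .or f g => ELSat D f ∨ ELSat D g

/-- `D` is a candidate child-label for a vertex labeled `L`:
`D ⊊ L` and `D ⊨ φ ⟺ L ⊭ φ`. -/
def ELCand {C : Type} [DecidableEq C] (φ : ELFormula C) (L D : Finset C) : Prop :=
  D ⊂ L ∧ (ELSat (↑D) φ ↔ ¬ ELSat (↑L) φ)

/-- `D` is maximal among the candidate child-labels for a vertex labeled `L`. -/
def ELMaxCand {C : Type} [DecidableEq C] (φ : ELFormula C) (L D : Finset C) : Prop :=
  ELCand φ L D ∧ ∀ D' : Finset C, ELCand φ L D' → D ⊆ D' → D = D'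

/-- The Zielonka tree of an Emerson-Lei formula `φ` over a finite set `C` of colors:
a finite tree rooted at `root`, whose root is labeled `C`, and in which every vertex `s`
has exactly one child labeled `D` for each `D` maximal among
`{D' ⊊ l(s) | D' ⊨ φ ⟺ l(s) ⊭ φ}`. -/
structure ZielonkaTree (C : Type) [Fintype C] [DecidableEq C] (φ : ELFormula C) where
  V : Type
  [finV : Fintype V]
  [decV : DecidableEq V]
  root : V
  children : V → Finset V
  label : V → Finset C
  root_label : label root = Finset.univ
  reach_root : ∀ t, Relation.ReflTransGen (fun a b => b ∈ children a) root t
  parent_unique : ∀ ⦃s s' t⦄, t ∈ children s → t ∈ children s' → s = s'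
  root_not_child : ∀ s, root ∉ children s
  child_maximal : ∀ ⦃s t⦄, t ∈ children s → ELMaxCand φ (label s) (label t)
  child_exists : ∀ ⦃s⦄ ⦃D : Finset C⦄, ELMaxCand φ (label s) D → ∃ t ∈ children s, label t = D
  child_label_inj : ∀ ⦃s t t'⦄, t ∈ children s → t' ∈ children s → label t = label t' → t = t'

attribute [instance] ZielonkaTree.finV ZielonkaTree.decV

/-- A game arena: a set of nodes (the type `N`) partitioned into existential nodes
(`Vex`) and universal nodes (the complement), with a move relation `E` such that every
node has at least one successor. -/
structure Arena (N : Type) where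
  Vex : Set N
  E : N → Set N
  E_nonempty : ∀ v, (E v).Nonempty

/-- A play of an arena: an infinite sequence of nodes following moves. -/
def Arena.IsPlay {N : Type} (A : Arena N) (π : ℕ → N) : Prop :=
  ∀ i, π (i + 1) ∈ A.E (π i)

/-- The existential player wins node `v` for objective `α`: there is a strategy
(mapping a history together with a current existential node to a successor) such that
every play starting at `v` and compliant with it satisfies `α`. -/
def WinsFrom {N : Type} (A : Arena N) (α : (ℕ → N) → Prop) (v : N) : Prop :=
  ∃ σ : List N → N → N,
    (∀ h u, u ∈ A.Vex → σ h u ∈ A.E u) ∧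
    ∀ π : ℕ → N, A.IsPlay π → π 0 = v →
      (∀ i, π i ∈ A.Vex → π (i + 1) = σ ((List.range i).map π) (π i)) → α π

/-- The Emerson-Lei objective `α_{γ,φ}`: the set of colors visited infinitely often
by the play satisfies `φ`. -/
def ELObjective {N C : Type} (γ : N → Finset C) (φ : ELFormula C) (π : ℕ → N) : Prop :=
  ELSat {c : C | ∀ M : ℕ, ∃ i ≥ M, c ∈ γ (π i)} φ

namespace ZielonkaTree

variable {C : Type} [Fintype C] [DecidableEq C] {φ : ELFormula C}

/-- The ancestor ordering of the Zielonka tree: `Z.anc s t` iff `s` is an ancestor of `t`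
(or `s = t`). -/
def anc (Z : ZielonkaTree C φ) (s t : Z.V) : Prop :=
  Relation.ReflTransGen (fun a b => b ∈ Z.children a) s t

/-- A leaf of the Zielonka tree. -/
def IsLeaf (Z : ZielonkaTree C φ) (t : Z.V) : Prop := Z.children t = ∅

/-- A winning vertex of the Zielonka tree (an element of `T_□`): its label satisfies `φ`. -/
def Winning (Z : ZielonkaTree C φ) (t : Z.V) : Prop := ELSat (↑(Z.label t)) φ

/-- `s` is the anchor node of `t` at a node colored `g`: the lowermost ancestor of `t`
whose label contains `g`. -/
def IsAnchor (Z : ZielonkaTree C φ) (g : Finset C) (t s : Z.V) : Prop :=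
  Z.anc s t ∧ g ⊆ Z.label s ∧ ∀ s', Z.anc s' t → g ⊆ Z.label s' → Z.anc s' s

end ZielonkaTree

/-- Being a leaf is decidable. -/
instance ZielonkaTree.decIsLeaf {C : Type} [Fintype C] [DecidableEq C] {φ : ELFormula C}
    (Z : ZielonkaTree C φ) (t : Z.V) : Decidable (Z.IsLeaf t) := by
  have : DecidableEq Z.V := Z.decV
  unfold ZielonkaTree.IsLeaf
  infer_instance

/-- The least fixpoint à la Knaster–Tarski: the intersection of all prefixpoints. -/
def klfp {α : Type} (f : Set α → Set α) : Set α := ⋂₀ {X | f X ⊆ X}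

/-- The greatest fixpoint à la Knaster–Tarski: the union of all postfixpoints. -/
def kgfp {α : Type} (f : Set α → Set α) : Set α := ⋃₀ {X | X ⊆ f X}

/-- The controllable predecessor operator:
`CPre(X) = {v ∈ V∃ | E(v) ∩ X ≠ ∅} ∪ {v ∈ V∀ | E(v) ⊆ X}`. -/
def CPre {N : Type} (A : Arena N) (X : Set N) : Set N :=
  {v | (v ∈ A.Vex ∧ (A.E v ∩ X).Nonempty) ∨ (v ∉ A.Vex ∧ A.E v ⊆ X)}

/-- The set `anc^s_t` of game nodes anchored at `s` relative to `t`: for `s = t` the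
nodes `v` with `γ(v) ⊆ l(t)`; for a strict ancestor `s` of `t` the nodes `v` with
`γ(v) ⊆ l(s)` whose colors are not contained in the label of the child of `s` leading
to `t`. -/
def ancSet {C N : Type} [Fintype C] [DecidableEq C] {φ : ELFormula C}
    (Z : ZielonkaTree C φ) (γ : N → Finset C) (s t : Z.V) : Set N :=
  letI : DecidableEq Z.V := Z.decV
  if s = t then {v | γ v ⊆ Z.label t}
  else {v | γ v ⊆ Z.label s ∧ ∀ c ∈ Z.children s, Z.anc c t → ¬ γ v ⊆ Z.label c}

open Classical in
/-- The nested Knaster–Tarski solution `⟦X_s⟧` of the Emerson-Lei equation system `S_φ`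
with the values of the variables of strict ancestors of `s` given by `env`:
for a non-leaf losing vertex, `X_s =_LFP ⋃_{t ∈ R(s)} X_t`; for a non-leaf winning
vertex, `X_s =_GFP ⋂_{t ∈ R(s)} X_t`; and for a leaf,
`X_s =_η ⋃_{s' ≤ s} (anc^{s'}_s ∩ CPre(X_{s'}))`, where `η = GFP` for winning vertices
and `η = LFP` for losing ones; variables are resolved from innermost to outermost. -/
noncomputable def ELSol {C N : Type} [Fintype C] [DecidableEq C] {φ : ELFormula C}
    (Z : ZielonkaTree C φ) (A : Arena N) (γ : N → Finset C)
    (s : Z.V) (env : Z.V → Set N) : Set N :=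
  letI : DecidableEq Z.V := Z.decV
  let F : Set N → Set N := fun X =>
    let env' : Z.V → Set N := fun u => if u = s then X else env u
    if Z.IsLeaf s then
      ⋃ s', ⋃ (_ : Z.anc s' s), ancSet Z γ s' s ∩ CPre A (env' s')
    else if Z.Winning s then
      ⋂ t : {t : Z.V // t ∈ Z.children s}, ELSol Z A γ t.1 env'
    else
      ⋃ t : {t : Z.V // t ∈ Z.children s}, ELSol Z A γ t.1 env'
  if Z.Winning s then kgfp F else klfp F
termination_by (Z.label s).card
decreasing_by all_goals exact Finset.card_lt_card (Z.child_maximal t.2).1.1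

open Classical in
/-- The iterates of the fixpoint loop of the procedure `Solve` at vertex `s` of the
Zielonka tree, with the values for the strict ancestors of `s` given by `env`:
`solveIter s env 0` is the initialization (`∅` for losing vertices, `V` for winning
ones), and `solveIter s env (n+1)` applies the body of the loop: for a leaf, the union
`⋃_{t ≤ s} (anc^t_s ∩ CPre((ls:X)(t)))`; for a non-leaf vertex, the union (for losing
`s`) or intersection (for winning `s`) of the recursively computed solutions
`Solve(t, ls:X)` over the children `t` of `s`, where `Solve(t, ls) = solveIter t ls |V|`
iterates the loop `|V|` times. -/
noncomputable def solveIter {C N : Type} [Fintype C] [DecidableEq C] [Fintype N]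
    {φ : ELFormula C} (Z : ZielonkaTree C φ) (A : Arena N) (γ : N → Finset C)
    (s : Z.V) (env : Z.V → Set N) : ℕ → Set N
  | 0 => if Z.Winning s then Set.univ else ∅
  | n + 1 =>
    letI : DecidableEq Z.V := Z.decV
    let X := solveIter Z A γ s env n
    let env' : Z.V → Set N := fun u => if u = s then X else env u
    if Z.IsLeaf s then
      ⋃ s', ⋃ (_ : Z.anc s' s), ancSet Z γ s' s ∩ CPre A (env' s')
    else if Z.Winning s then
      ⋂ t : {t : Z.V // t ∈ Z.children s}, solveIter Z A γ t.1 env' (Fintype.card N)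
    else
      ⋃ t : {t : Z.V // t ∈ Z.children s}, solveIter Z A γ t.1 env' (Fintype.card N)
termination_by n => ((Z.label s).card, n)
decreasing_by
  · exact Prod.Lex.right _ (Nat.lt_succ_self n)
  · exact Prod.Lex.left _ _ (Finset.card_lt_card (Z.child_maximal t.2).1.1)
  · exact Prod.Lex.left _ _ (Finset.card_lt_card (Z.child_maximal t.2).1.1)

/-- The result of the procedure `Solve(s, ls)`: iterate the fixpoint loop `|V|` times
(by which time it has stabilized). -/
noncomputable def solve {C N : Type} [Fintype C] [DecidableEq C] [Fintype N]
    {φ : ELFormula C} (Z : ZielonkaTree C φ) (A : Arena N) (γ : N → Finset C)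
    (s : Z.V) (env : Z.V → Set N) : Set N :=
  solveIter Z A γ s env (Fintype.card N)

theorem klfp_mono {α : Type} {f g : Set α → Set α} (h : ∀ X, f X ⊆ g X) :
    klfp f ⊆ klfp g :=
  Set.sInter_subset_sInter fun _ hX => (h _).trans hX

theorem kgfp_mono {α : Type} {f g : Set α → Set α} (h : ∀ X, f X ⊆ g X) :
    kgfp f ⊆ kgfp g :=
  Set.sUnion_subset_sUnion fun _ hX => Set.Subset.trans hX (h _)

theorem compl_kgfp {α : Type} (f : Set α → Set α) :
    (kgfp f)ᶜ = klfp fun X => (f Xᶜ)ᶜ := by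
  ext v
  simp only [kgfp, klfp, Set.mem_compl_iff, Set.mem_sUnion, Set.mem_sInter, Set.mem_ofPred_eq,
    not_exists, not_and]
  constructor
  · intro h X hX
    by_contra hv
    exact h Xᶜ (Set.compl_subset_comm.mp hX) hv
  · intro h X hX hv
    exact h Xᶜ (by simpa using hX) hv

/-- The Kleene iteration of a monotone operator on subsets of a finite type, started at the
empty set, reaches the least fixpoint after at most as many steps as the type has elements. -/
theorem iterate_empty_eq_klfp {N : Type} [Fintype N] {f : Set N → Set N} (hf : Monotone f)
    {u : ℕ → Set N} (h_zero : u 0 = ∅) (h_succ : ∀ n, u (n + 1) = f (u n))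
    {n : ℕ} (hn : Fintype.card N ≤ n) : u n = klfp f := by
  have h_step : ∀ n, u n ⊆ u (n + 1) := by
    intro n
    induction n with
    | zero => simp [h_zero]
    | succ n ih => rw [h_succ n, h_succ (n + 1)]; exact hf ih
  have h_le : ∀ n, u n ⊆ klfp f := by
    intro n
    induction n with
    | zero => simp [h_zero]
    | succ n ih =>
      intro v hv X hX
      rw [h_succ] at hv
      exact hX (hf (ih.trans (Set.sInter_subset_of_mem hX)) hv)
  have h_grow : ∀ m, u m ≠ u (m + 1) → m + 1 ≤ (u (m + 1)).ncard := by
    intro m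
    induction m with
    | zero =>
      intro hm
      have := Set.ncard_lt_ncard ((h_step 0).ssubset_of_ne hm)
      omega
    | succ m ih =>
      intro hm
      have := Set.ncard_lt_ncard ((h_step (m + 1)).ssubset_of_ne hm)
      have := ih fun e => hm (by rw [h_succ m, h_succ (m + 1), ← e])
      omega
  have h_fix : u n = u (n + 1) := by
    by_contra h
    have := h_grow n h
    have := Set.ncard_le_card (u (n + 1))
    rw [Nat.card_eq_fintype_card] at this
    omega
  refine (h_le n).antisymm (Set.sInter_subset_of_mem ?_)
  change f (u n) ⊆ u n
  rw [← h_succ, ← h_fix]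

/-- Dual of `iterate_empty_eq_klfp`. -/
theorem iterate_univ_eq_kgfp {N : Type} [Fintype N] {f : Set N → Set N} (hf : Monotone f)
    {u : ℕ → Set N} (h_zero : u 0 = Set.univ) (h_succ : ∀ n, u (n + 1) = f (u n))
    {n : ℕ} (hn : Fintype.card N ≤ n) : u n = kgfp f := by
  apply compl_injective
  rw [compl_kgfp]
  exact iterate_empty_eq_klfp (u := fun n => (u n)ᶜ)
    (fun X Y h => Set.compl_subset_compl.mpr (hf (Set.compl_subset_compl.mpr h)))
    (by simp [h_zero]) (fun n => by simp [h_succ]) hn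

theorem CPre_mono {N : Type} (A : Arena N) : Monotone (CPre A) := by
  rintro X Y h v (⟨hv, hX⟩ | ⟨hv, hX⟩)
  · exact .inl ⟨hv, hX.mono (Set.inter_subset_inter_right _ h)⟩
  · exact .inr ⟨hv, hX.trans h⟩

section

variable {C N : Type} [Fintype C] [DecidableEq C] {φ : ELFormula C}
  (Z : ZielonkaTree C φ) (A : Arena N) (γ : N → Finset C)

open Classical in
/-- The right-hand side of the equation for `X_s`, as a function of the value `X` of `X_s`
itself, with the values of the variables of the children of `s` given by `S`. -/
noncomputable def elBody (S : Z.V → (Z.V → Set N) → Set N) (s : Z.V) (env : Z.V → Set N)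
    (X : Set N) : Set N :=
  let env' : Z.V → Set N := fun u => if u = s then X else env u
  if Z.IsLeaf s then
    ⋃ s', ⋃ (_ : Z.anc s' s), ancSet Z γ s' s ∩ CPre A (env' s')
  else if Z.Winning s then
    ⋂ t : {t : Z.V // t ∈ Z.children s}, S t.1 env'
  else
    ⋃ t : {t : Z.V // t ∈ Z.children s}, S t.1 env'

variable {Z} in
theorem elBody_mono {S : Z.V → (Z.V → Set N) → Set N} {s : Z.V}
    (hS : ∀ t ∈ Z.children s, Monotone (S t)) {env₁ env₂ : Z.V → Set N} (h_env : env₁ ≤ env₂)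
    {X Y : Set N} (hXY : X ⊆ Y) : elBody Z A γ S s env₁ X ⊆ elBody Z A γ S s env₂ Y := by
  have h_upd : (fun u => if u = s then X else env₁ u) ≤ fun u => if u = s then Y else env₂ u := by
    intro u
    dsimp only
    split_ifs
    exacts [hXY, h_env u]
  unfold elBody
  dsimp only
  split_ifs
  · exact Set.iUnion₂_mono fun s' _ =>
      Set.inter_subset_inter_right _ (CPre_mono A (by convert h_upd s'))
  · exact Set.iInter_mono fun t => hS t.1 t.2 (by convert h_upd)
  · exact Set.iUnion_mono fun t => hS t.1 t.2 (by convert h_upd)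

variable {Z} in
theorem elBody_congr {S S' : Z.V → (Z.V → Set N) → Set N} {s : Z.V}
    (hS : ∀ t ∈ Z.children s, S t = S' t) (env : Z.V → Set N) :
    elBody Z A γ S s env = elBody Z A γ S' s env := by
  have h : ∀ t : {t : Z.V // t ∈ Z.children s}, S t.1 = S' t.1 := fun t => hS t.1 t.2
  funext X
  simp only [elBody, h]

open Classical in
theorem ELSol_eq (s : Z.V) (env : Z.V → Set N) :
    ELSol Z A γ s env =
      if Z.Winning s then kgfp (elBody Z A γ (ELSol Z A γ) s env)
      else klfp (elBody Z A γ (ELSol Z A γ) s env) := by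
  have h : elBody Z A γ (ELSol Z A γ) s env = fun X => elBody Z A γ (ELSol Z A γ) s env X := rfl
  rw [ELSol, h]
  unfold elBody
  congr! 3

theorem solveIter_succ [Fintype N] (s : Z.V) (env : Z.V → Set N) (n : ℕ) :
    solveIter Z A γ s env (n + 1) =
      elBody Z A γ (solve Z A γ) s env (solveIter Z A γ s env n) := by
  rw [solveIter]
  unfold elBody solve
  congr! 3

theorem ELSol_mono (s : Z.V) : Monotone (ELSol Z A γ s) := by
  induction h : (Z.label s).card using Nat.strong_induction_on generalizing s with
  | _ k ih =>
    have hS : ∀ t ∈ Z.children s, Monotone (ELSol Z A γ t) := fun t ht =>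
      ih _ (h ▸ Finset.card_lt_card (Z.child_maximal ht).1.1) t rfl
    intro env₁ env₂ h_env
    rw [ELSol_eq, ELSol_eq]
    split_ifs
    · exact kgfp_mono fun X => elBody_mono A γ hS h_env subset_rfl
    · exact klfp_mono fun X => elBody_mono A γ hS h_env subset_rfl

/-- From iteration `|V|` on, every fixpoint loop of `Solve` has reached the solution. -/
theorem solveIter_eq_ELSol [Fintype N] (s : Z.V) (env : Z.V → Set N) {n : ℕ}
    (hn : Fintype.card N ≤ n) : solveIter Z A γ s env n = ELSol Z A γ s env := by
  induction h : (Z.label s).card using Nat.strong_induction_on generalizing s env n with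
  | _ k ih =>
    have hS : ∀ t ∈ Z.children s, solve Z A γ t = ELSol Z A γ t := fun t ht =>
      funext fun env =>
        ih _ (h ▸ Finset.card_lt_card (Z.child_maximal ht).1.1) t env le_rfl rfl
    have h_succ : ∀ n, solveIter Z A γ s env (n + 1) =
        elBody Z A γ (ELSol Z A γ) s env (solveIter Z A γ s env n) := fun n => by
      rw [solveIter_succ, elBody_congr A γ hS]
    have h_mono : Monotone (elBody Z A γ (ELSol Z A γ) s env) := fun X Y hXY =>
      elBody_mono A γ (fun t _ => ELSol_mono Z A γ t) le_rfl hXY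
    rw [ELSol_eq]
    split_ifs with hw
    · exact iterate_univ_eq_kgfp h_mono (by simp [solveIter, hw]) h_succ hn
    · exact iterate_empty_eq_klfp h_mono (by simp [solveIter, hw]) h_succ hn

end

/-- The procedure `Solve` computes the solution of the Emerson-Lei equation system:
`Solve(r, []) = ⟦X_r⟧` at the root `r` of the Zielonka tree; in particular the procedure
terminates, each fixpoint loop stabilizing after at most `|V|` iterations. -/
theorem solve_root_eq_ELSol_and_stabilizes
    {C N : Type} [Fintype C] [DecidableEq C] [Fintype N]
    (φ : ELFormula C) (Z : ZielonkaTree C φ) (A : Arena N) (γ : N → Finset C) :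
    solve Z A γ Z.root (fun _ => ∅) = ELSol Z A γ Z.root (fun _ => ∅) ∧
    (∀ (s : Z.V) (env : Z.V → Set N) (n : ℕ), Fintype.card N ≤ n →
      solveIter Z A γ s env n = solveIter Z A γ s env (Fintype.card N)) := by
  exact ⟨solveIter_eq_ELSol Z A γ _ _ le_rfl, fun s env n hn =>
    (solveIter_eq_ELSol Z A γ s env hn).trans (solveIter_eq_ELSol Z A γ s env le_rfl).symm⟩
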